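/- (Lemma A.2, quantum-plane form.) Let e be a positive integer, β, β' integers, ε ∈ {+1, −1}, and ℓ ≥ 0 an integer. In the completed quantum plane A_{2e} (so Y₂Y₁ = v^{4e}·Y₁Y₂), both of the following identities hold: (i) Ψ_{v^e}(v^{β'}·Y₂) · →∏_{p=0..ℓ} Ψ_{v^{2e}}(v^{β+2pβ'+2pεe}·y^{(1,2p)}) = Ψ_{v^{2e}}(v^{β}·Y₁) · (→∏_{p=1..2ℓ+1} Ψ_{v^{e}}(v^{β+pβ'+(p−1)εe}·y^{(1,p)})) · Ψ_{v^{2e}}(v^{β+(2ℓ+2)β'+2ℓεe}·y^{(1,2ℓ+2)}) · Ψ_{v^{e}}(v^{β'}·Y₂); and (ii) (←∏_{p=0..ℓ} Ψ_{v^{2e}}(v^{2pβ+β'+2pεe}·y^{(2p,1)})) · Ψ_{v^{e}}(v^{β}·Y₁) = Ψ_{v^{e}}(v^{β}·Y₁) · Ψ_{v^{2e}}(v^{(2ℓ+2)β+β'+2ℓεe}·y^{(2ℓ+2,1)}) · (←∏_{p=1..2ℓ+1} Ψ_{v^{e}}(v^{pβ+β'+(p−1)εe}·y^{(p,1)}))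 · Ψ_{v^{2e}}(v^{β'}·Y₂). -/

import Mathlib

noncomputable section

open Filter

abbrev K : Type := RatFunc ℚ

/-- The indeterminate generator `v` of `K = ℚ(v)`. -/
def v : K := RatFunc.X

/-- The completed quantum plane: formal series `Σ c_{m,n}·Y₁^m Y₂^n`, encoded as
coefficient functions `ℕ × ℕ → K`. -/
abbrev QP : Type := (ℕ × ℕ) → K

/-- The twisted product of the completed quantum plane `A_γ`:
`(Y₁^a Y₂^b)·(Y₁^{a'} Y₂^{b'}) = v^{2γba'}·Y₁^{a+a'} Y₂^{b+b'}`, extended bilinearly and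
continuously for the coefficientwise topology. -/
def qmul (γ : ℕ) (F G : QP) : QP := fun p =>
  ∑ a ∈ Finset.range (p.1 + 1), ∑ b ∈ Finset.range (p.2 + 1),
    v ^ (2 * γ * b * (p.1 - a)) * F (a, b) * G (p.1 - a, p.2 - b)

/-- The multiplicative unit of the completed quantum plane. -/
def qone : QP := fun p => if p = (0, 0) then 1 else 0

/-- Powers in the completed quantum plane. -/
def qpow (γ : ℕ) (Z : QP) : ℕ → QP
  | 0 => qone
  | k + 1 => qmul γ Z (qpow γ Z k)

/-- The element `v^β · y^{(m,n)} = v^{β + γmn} · Y₁^m Y₂^n` of `A_γ`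
(`y^{(m,n)} := v^{γmn}·Y₁^m Y₂^n` is the normalized quantum monomial). -/
def qy (γ : ℕ) (β : ℤ) (m n : ℕ) : QP := fun p =>
  if p = (m, n) then v ^ (β + (γ : ℤ) * (m : ℤ) * (n : ℤ)) else 0

/-- The series `Σ_{j≥1} ((−1)^{j+1}/(j·(w^j − w^{−j})))·Z^j` (for `Z` with zero
constant term, the coefficient at `(m,n)` only involves `j ≤ m + n`). -/
def qarg (γ : ℕ) (w : K) (Z : QP) : QP := fun r =>
  ∑ j ∈ Finset.Icc 1 (r.1 + r.2),
    ((-1 : K) ^ (j + 1) / ((j : K) * (w ^ j - w⁻¹ ^ j))) * qpow γ Z j r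

/-- The quantum dilogarithm `Ψ_w(Z) = exp(Σ_{j≥1} ((−1)^{j+1}/(j(w^j − w^{−j})))·Z^j)`
in `A_γ`, for `Z` with zero constant term. -/
def qPsi (γ : ℕ) (w : K) (Z : QP) : QP := fun p =>
  ∑ k ∈ Finset.range (p.1 + p.2 + 1),
    ((Nat.factorial k : K)⁻¹) * qpow γ (qarg γ w Z) k p

/-- The ordered product `→∏_{p=a..b} g_p = g_a g_{a+1} ⋯ g_b` in `A_γ`. -/
def qprodR (γ : ℕ) (g : ℕ → QP) (a b : ℕ) : QP :=
  ((List.range' a (b + 1 - a)).map g).foldr (qmul γ) qone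

/-- The ordered product `←∏_{p=a..b} g_p = g_b ⋯ g_{a+1} g_a` in `A_γ`. -/
def qprodL (γ : ℕ) (g : ℕ → QP) (a b : ℕ) : QP :=
  ((List.range' a (b + 1 - a)).reverse.map g).foldr (qmul γ) qone

open PowerSeries

theorem PowerSeries.eq_of_derivative_eq_mul {F : Type*} [Field F] [CharZero F] {a f h : F⟦X⟧}
    (h0 : coeff 0 f = coeff 0 h) (hf : d⁄dX F f = a * f) (hh : d⁄dX F h = a * h) : f = h := by
  ext n
  induction n using Nat.strong_induction_on with
  | _ n ih =>
    cases n with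
    | zero => exact h0
    | succ n =>
      have h1 := congrArg (coeff n) hf
      have h2 := congrArg (coeff n) hh
      rw [coeff_derivative, coeff_mul] at h1 h2
      have h3 : ∑ p ∈ Finset.HasAntidiagonal.antidiagonal n, coeff p.1 a * coeff p.2 f
          = ∑ p ∈ Finset.HasAntidiagonal.antidiagonal n, coeff p.1 a * coeff p.2 h := by
        refine Finset.sum_congr rfl fun p hp => ?_
        rw [ih p.2 (by have := Finset.HasAntidiagonal.mem_antidiagonal.1 hp; omega)]
      have hn : (n : F) + 1 ≠ 0 := Nat.cast_add_one_ne_zero n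
      exact mul_right_cancel₀ hn (by rw [h1, h2, h3])

/-- The composite `exp ∘ g`, for `g` without constant term. -/
def expComp {F : Type*} [Field F] (g : F⟦X⟧) : F⟦X⟧ :=
  PowerSeries.mk fun j => ∑ k ∈ Finset.range (j + 1), (k.factorial : F)⁻¹ * coeff j (g ^ k)

section expComp
variable {F : Type*} [Field F] {g : F⟦X⟧}

theorem coeff_expComp (hg : coeff 0 g = 0) {j N : ℕ} (hN : j < N) :
    coeff j (expComp g) = ∑ k ∈ Finset.range N, (k.factorial : F)⁻¹ * coeff j (g ^ k) := by
  rw [expComp, coeff_mk]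
  refine Finset.sum_subset (Finset.range_mono hN) fun k _ hk => ?_
  have hX : (X : F⟦X⟧) ∣ g := X_dvd_iff.2 (by simpa using hg)
  rw [X_pow_dvd_iff.1 (pow_dvd_pow_of_dvd hX k) j (by simpa [Nat.succ_le_iff] using hk), mul_zero]

theorem derivative_expComp [CharZero F] (hg : coeff 0 g = 0) :
    d⁄dX F (expComp g) = d⁄dX F g * expComp g := by
  ext j
  have hsum : ∀ i < j + 1, coeff i (expComp g)
      = coeff i (∑ k ∈ Finset.range (j + 1), C ((k.factorial : F)⁻¹) * g ^ k) := fun i hi => by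
    simp [coeff_expComp hg hi]
  have hR : coeff j (d⁄dX F g * expComp g)
      = coeff j (d⁄dX F g * ∑ k ∈ Finset.range (j + 1), C ((k.factorial : F)⁻¹) * g ^ k) := by
    rw [coeff_mul, coeff_mul]
    refine Finset.sum_congr rfl fun p hp => ?_
    rw [hsum p.2 (by have := Finset.HasAntidiagonal.mem_antidiagonal.1 hp; omega)]
  rw [hR, coeff_derivative, coeff_expComp hg (Nat.lt_succ_self (j + 1)), Finset.sum_range_succ',
    Finset.mul_sum, map_sum, add_mul, Finset.sum_mul]
  simp only [pow_zero, coeff_one, Nat.succ_ne_zero, if_false, mul_zero, zero_mul, add_zero]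
  refine Finset.sum_congr rfl fun k _ => ?_
  have h1 := coeff_derivative (g ^ (k + 1)) j
  rw [mul_assoc, ← h1, Derivation.leibniz_pow]
  have hk : ((k + 1 : ℕ) : F) ≠ 0 := Nat.cast_ne_zero.2 (Nat.succ_ne_zero k)
  have hkf : (k.factorial : F) ≠ 0 := Nat.cast_ne_zero.2 k.factorial_ne_zero
  rw [mul_left_comm, coeff_C_mul, map_nsmul, nsmul_eq_mul, Nat.factorial_succ,
    add_tsub_cancel_right, smul_eq_mul, mul_comm (d⁄dX F g)]
  push_cast at hk ⊢
  field_simp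

end expComp

/-- The logarithm `Σ_{j≥1} ((−1)^{j+1}/(j(w^j − w^{−j}))) z^j` of the quantum dilogarithm. -/
def dilogExponent (w : K) : K⟦X⟧ :=
  PowerSeries.mk fun j => (-1 : K) ^ (j + 1) / ((j : K) * (w ^ j - w⁻¹ ^ j))

/-- The quantum dilogarithm as a power series in one variable. -/
def dilog (w : K) : K⟦X⟧ := expComp (dilogExponent w)

theorem coeff_zero_dilogExponent (w : K) : coeff 0 (dilogExponent w) = 0 := by
  simp [dilogExponent]

theorem coeff_zero_dilog (w : K) : coeff 0 (dilog w) = 1 := by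
  simp [dilog, expComp]

theorem derivative_dilog (w : K) :
    d⁄dX K (dilog w) = d⁄dX K (dilogExponent w) * dilog w :=
  derivative_expComp (coeff_zero_dilogExponent w)

theorem coeff_derivative_dilogExponent (w : K) (j : ℕ) :
    coeff j (d⁄dX K (dilogExponent w)) = (-1 : K) ^ j / (w ^ (j + 1) - w⁻¹ ^ (j + 1)) := by
  have hj : ((j : K) + 1) ≠ 0 := Nat.cast_add_one_ne_zero j
  rw [coeff_derivative, dilogExponent, coeff_mk]
  push_cast
  rw [pow_add, pow_add (-1 : K)]
  field_simp

theorem derivative_rescale (c : K) (f : K⟦X⟧) :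
    d⁄dX K (rescale c f) = C c * rescale c (d⁄dX K f) := by
  ext j
  simp only [coeff_derivative, coeff_rescale, coeff_C_mul]
  ring

theorem pow_sub_inv_pow_ne_zero {w : K} (hw0 : w ≠ 0) (hw : ∀ k : ℕ, w ^ (k + 1) ≠ 1) (j : ℕ) :
    w ^ (j + 1) - w⁻¹ ^ (j + 1) ≠ 0 := fun h => by
  refine hw (2 * j + 1) ?_
  have h1 : w ^ (2 * j + 1 + 1) = w ^ (j + 1) * w ^ (j + 1) := by ring
  rw [h1]
  nth_rw 2 [sub_eq_zero.1 h]
  rw [← mul_pow, mul_inv_cancel₀ hw0, one_pow]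

theorem rescale_sq_dilog {w : K} (hw0 : w ≠ 0) (hw : ∀ k : ℕ, w ^ (k + 1) ≠ 1) :
    rescale (w ^ 2) (dilog w) = (1 + C w * X) * dilog w := by
  have key : (1 + C w * X) * (C (w ^ 2) * rescale (w ^ 2) (d⁄dX K (dilogExponent w)))
      = C w + (1 + C w * X) * d⁄dX K (dilogExponent w) := by
    have hd : C (w ^ 2) * rescale (w ^ 2) (d⁄dX K (dilogExponent w))
        = PowerSeries.mk (fun j => (-1) ^ j * w ^ (j + 1)) + d⁄dX K (dilogExponent w) := by
      ext j
      have hD := pow_sub_inv_pow_ne_zero hw0 hw j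
      have hDw : w ^ (j + 1) * (w ^ (j + 1) - w⁻¹ ^ (j + 1)) = w ^ 2 * (w ^ 2) ^ j - 1 := by
        rw [mul_sub, ← mul_pow w w⁻¹, mul_inv_cancel₀ hw0]
        ring
      simp only [coeff_C_mul, coeff_rescale, coeff_derivative_dilogExponent, map_add, coeff_mk]
      generalize w ^ (j + 1) - w⁻¹ ^ (j + 1) = D at hD hDw
      field_simp
      linear_combination -hDw
    have hm : (1 + C w * X) * PowerSeries.mk (fun j => (-1) ^ j * w ^ (j + 1)) = C w := by
      ext j
      rw [add_mul, one_mul, mul_assoc, map_add, coeff_C_mul]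
      cases j with
      | zero => simp
      | succ j =>
        simp only [coeff_mk, coeff_succ_X_mul, coeff_C, Nat.succ_ne_zero, if_false]
        ring
    rw [hd, mul_add, hm]
  refine PowerSeries.eq_of_derivative_eq_mul
    (a := C (w ^ 2) * rescale (w ^ 2) (d⁄dX K (dilogExponent w))) ?_ ?_ ?_
  · rw [coeff_rescale, add_mul, map_add, mul_assoc, coeff_C_mul, coeff_zero_X_mul]
    simp
  · rw [derivative_rescale, derivative_dilog, map_mul, mul_assoc]
  · rw [← mul_assoc, mul_comm (C (w ^ 2) * _) (1 + C w * X), key, Derivation.leibniz,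
      derivative_dilog]
    simp only [map_add, Derivation.leibniz, derivative_C, derivative_X, smul_eq_mul,
      Derivation.map_one_eq_zero]
    ring

theorem coeff_succ_dilog {w : K} (hw0 : w ≠ 0) (hw : ∀ k : ℕ, w ^ (k + 1) ≠ 1) (k : ℕ) :
    (w ^ (2 * (k + 1)) - 1) * coeff (k + 1) (dilog w) = w * coeff k (dilog w) := by
  have h := congrArg (coeff (k + 1)) (rescale_sq_dilog hw0 hw)
  rw [coeff_rescale, add_mul, one_mul, mul_assoc, map_add, coeff_C_mul, coeff_succ_X_mul] at h
  rw [pow_mul]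
  linear_combination h

theorem dilog_eq_rescale_mul_rescale {q : K} (hq0 : q ≠ 0) (hq : ∀ k : ℕ, q ^ (k + 1) ≠ 1) :
    dilog q = rescale q (dilog (q ^ 2)) * rescale q⁻¹ (dilog (q ^ 2)) := by
  have hq2 : ∀ k : ℕ, (q ^ 2) ^ (k + 1) ≠ 1 := fun k => by
    rw [← pow_mul]; exact hq (2 * k + 1)
  have key : C q * rescale q (d⁄dX K (dilogExponent (q ^ 2)))
      + C q⁻¹ * rescale q⁻¹ (d⁄dX K (dilogExponent (q ^ 2))) = d⁄dX K (dilogExponent q) := by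
    ext j
    have h1 := pow_sub_inv_pow_ne_zero hq0 hq j
    have h2 := pow_sub_inv_pow_ne_zero (pow_ne_zero 2 hq0) hq2 j
    simp only [coeff_C_mul, coeff_rescale, coeff_derivative_dilogExponent, map_add]
    rw [← mul_assoc, ← mul_assoc, ← pow_succ', ← pow_succ', ← add_mul, mul_div_assoc',
      div_eq_div_iff h2 h1]
    rw [← pow_mul, ← inv_pow, ← pow_mul, mul_comm 2, pow_mul, pow_mul]
    ring
  refine PowerSeries.eq_of_derivative_eq_mul (a := d⁄dX K (dilogExponent q)) ?_
    (derivative_dilog q) ?_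
  · rw [coeff_mul]
    simp [coeff_rescale, coeff_zero_dilog, -coeff_zero_eq_constantCoeff]
  · rw [← key, Derivation.leibniz, derivative_rescale, derivative_rescale, derivative_dilog]
    simp only [map_mul, smul_eq_mul]
    ring

/-- The polynomial `Σ_{k≤a} c_{a-k} c_k w^{k²} z^k`, where `c` are the coefficients of `dilog w`. -/
def dilogFactor (w : K) (a : ℕ) : K⟦X⟧ :=
  PowerSeries.mk fun k =>
    if k ≤ a then coeff (a - k) (dilog w) * coeff k (dilog w) * w ^ (k ^ 2) else 0

theorem dilogFactor_succ {w : K} (hw0 : w ≠ 0) (hw : ∀ k : ℕ, w ^ (k + 1) ≠ 1) (a : ℕ) :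
    C (w ^ (2 * (a + 1)) - 1) * dilogFactor w (a + 1)
      = C w * ((1 + C (w ^ (2 * a + 1)) * X) * dilogFactor w a) := by
  have hc := coeff_succ_dilog hw0 hw
  ext k
  rw [add_mul, one_mul, mul_assoc, coeff_C_mul, coeff_C_mul, map_add, coeff_C_mul]
  cases k with
  | zero =>
    simp only [dilogFactor, coeff_mk, coeff_zero_X_mul, Nat.zero_le, if_true, Nat.sub_zero]
    linear_combination coeff 0 (dilog w) * hc a
  | succ k =>
    rw [coeff_succ_X_mul]
    simp only [dilogFactor, coeff_mk, add_le_add_iff_right, Nat.add_sub_add_right]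
    rcases lt_trichotomy k a with h | rfl | h
    · obtain ⟨d, rfl⟩ := Nat.exists_eq_add_of_lt h
      have h1 := hc d
      have h2 := hc k
      rw [if_pos h.le, if_pos h.le, if_pos (by omega), show k + d + 1 - k = d + 1 by omega,
        show k + d + 1 - (k + 1) = d by omega]
      linear_combination w ^ ((k + 1) ^ 2) * coeff (k + 1) (dilog w) * h1
        + w ^ ((k + 1) ^ 2 + 2 * (d + 1)) * coeff (d + 1) (dilog w) * h2
    · have h2 := hc k
      rw [if_pos le_rfl, if_pos le_rfl, if_neg (by omega), Nat.sub_self]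
      linear_combination w ^ ((k + 1) ^ 2) * coeff 0 (dilog w) * h2
    · rw [if_neg (by omega), if_neg (by omega), if_neg (by omega)]
      simp

theorem dilog_mul_dilogFactor {w : K} (hw0 : w ≠ 0) (hw : ∀ k : ℕ, w ^ (k + 1) ≠ 1) (a : ℕ) :
    dilogFactor w a * dilog w = C (coeff a (dilog w)) * rescale (w ^ (2 * a)) (dilog w) := by
  induction a with
  | zero =>
    have : dilogFactor w 0 = 1 := by
      ext k
      cases k <;> simp [dilogFactor, coeff_one, coeff_zero_dilog, -coeff_zero_eq_constantCoeff]
    rw [this, coeff_zero_dilog]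
    simp
  | succ a ih =>
    have hne : (C (w ^ (2 * (a + 1)) - 1) : K⟦X⟧) ≠ 0 := fun h => by
      have := congrArg (coeff 0) h
      rw [coeff_zero_C, map_zero, sub_eq_zero] at this
      exact hw (2 * a + 1) this
    refine mul_left_cancel₀ hne ?_
    have hC : rescale (w ^ (2 * a)) (C w) = C w := by
      ext k
      rw [coeff_rescale, coeff_C]
      split_ifs with hk <;> simp [hk]
    have hr : rescale (w ^ (2 * (a + 1))) (dilog w)
        = (1 + C (w ^ (2 * a + 1)) * X) * rescale (w ^ (2 * a)) (dilog w) := by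
      rw [show w ^ (2 * (a + 1)) = w ^ 2 * w ^ (2 * a) by ring, ← rescale_rescale,
        rescale_sq_dilog hw0 hw, map_mul, map_add, map_mul, map_one, hC, rescale_X,
        ← mul_assoc (C w), ← map_mul, pow_succ' w (2 * a)]
    rw [← mul_assoc, dilogFactor_succ hw0 hw, hr, ← mul_assoc (C _) (C _), ← map_mul,
      coeff_succ_dilog hw0 hw, map_mul]
    linear_combination C w * (1 + C (w ^ (2 * a + 1)) * X) * ih

section QuantumPlane

theorem v_ne_zero : v ≠ 0 := RatFunc.X_ne_zero

theorem v_pow_ne_one {m : ℕ} (hm : m ≠ 0) : v ^ m ≠ 1 := fun h => by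
  have h1 : algebraMap (Polynomial ℚ) (RatFunc ℚ) (Polynomial.X ^ m)
      = algebraMap (Polynomial ℚ) (RatFunc ℚ) 1 := by
    rw [map_pow, RatFunc.algebraMap_X, map_one]
    exact h
  have h2 := congrArg Polynomial.natDegree (RatFunc.algebraMap_injective ℚ h1)
  rw [Polynomial.natDegree_X_pow, Polynomial.natDegree_one] at h2
  exact hm h2

theorem qmul_assoc (γ : ℕ) (F G H : QP) :
    qmul γ (qmul γ F G) H = qmul γ F (qmul γ G H) := by
  funext ⟨m, n⟩
  have flip : ∀ (N : ℕ) (f : ℕ → ℕ → ℕ → K),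
      ∑ a ∈ Finset.range (N + 1), ∑ b ∈ Finset.range (a + 1), f b (a - b) (N - a)
        = ∑ b ∈ Finset.range (N + 1), ∑ c ∈ Finset.range (N - b + 1), f b c (N - b - c) := by
    intro N f
    have h := Finset.sum_range_diag_flip (N + 1) fun b c => f b c (N - b - c)
    refine Eq.trans ?_ (h.trans ?_)
    · refine Finset.sum_congr rfl fun a _ => Finset.sum_congr rfl fun b hb => ?_
      rw [show N - b - (a - b) = N - a by have := Finset.mem_range.1 hb; omega]
    · refine Finset.sum_congr rfl fun b hb => ?_
      rw [show N - b + 1 = N + 1 - b by have := Finset.mem_range.1 hb; omega]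
  simp only [qmul, Finset.mul_sum, Finset.sum_mul]
  have h1 : ∀ a, ∑ b ∈ Finset.range (n + 1), ∑ a' ∈ Finset.range (a + 1),
        ∑ b' ∈ Finset.range (b + 1), v ^ (2 * γ * b * (m - a)) *
          (v ^ (2 * γ * b' * (a - a')) * F (a', b') * G (a - a', b - b')) * H (m - a, n - b)
      = ∑ a' ∈ Finset.range (a + 1), ∑ b' ∈ Finset.range (n + 1),
          ∑ b ∈ Finset.range (n - b' + 1), v ^ (2 * γ * (b' + b) * (m - a)) *
          (v ^ (2 * γ * b' * (a - a')) * F (a', b') * G (a - a', b)) * H (m - a, n - b' - b) := by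
    intro a
    rw [Finset.sum_comm]
    refine Finset.sum_congr rfl fun a' _ => ?_
    rw [← flip n fun b' b c => v ^ (2 * γ * (b' + b) * (m - a)) *
          (v ^ (2 * γ * b' * (a - a')) * F (a', b') * G (a - a', b)) * H (m - a, c)]
    refine Finset.sum_congr rfl fun b _ => Finset.sum_congr rfl fun b' hb => ?_
    rw [show b' + (b - b') = b by have := Finset.mem_range.1 hb; omega]
  simp only [h1]
  rw [flip m fun a' a c => ∑ b' ∈ Finset.range (n + 1),
          ∑ b ∈ Finset.range (n - b' + 1), v ^ (2 * γ * (b' + b) * c) *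
          (v ^ (2 * γ * b' * a) * F (a', b') * G (a, b)) * H (c, n - b' - b)]
  refine Finset.sum_congr rfl fun a' _ => ?_
  rw [Finset.sum_comm]
  refine Finset.sum_congr rfl fun b' _ => Finset.sum_congr rfl fun a ha =>
    Finset.sum_congr rfl fun b _ => ?_
  obtain ⟨c, hc⟩ : ∃ c, m - a' = a + c :=
    Nat.exists_eq_add_of_le (by have := Finset.mem_range.1 ha; omega)
  rw [hc, Nat.add_sub_cancel_left]
  ring

/-- The element `f(v^β y^{(1,n)})` of the quantum plane, for a power series `f`. -/
def ray (γ : ℕ) (β : ℤ) (n : ℕ) (f : K⟦X⟧) : QP := fun p =>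
  if p.2 = n * p.1 then coeff p.1 f * v ^ (β * p.1 + (γ * n * p.1 ^ 2 : ℕ)) else 0

/-- The anti-automorphism of the quantum plane exchanging `Y₁` and `Y₂`. -/
def transpose (F : QP) : QP := fun p => F p.swap

theorem qone_eq_ray (γ : ℕ) (β : ℤ) (n : ℕ) : qone = ray γ β n 1 := by
  funext ⟨a, b⟩
  rcases Nat.eq_zero_or_pos a with rfl | ha
  · simp [qone, ray]
  · simp [qone, ray, coeff_one, ha.ne']

theorem qy_eq_ray (γ : ℕ) (β : ℤ) (n : ℕ) : qy γ β 1 n = ray γ β n X := by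
  funext ⟨a, b⟩
  by_cases ha : a = 1
  · subst ha
    simp [qy, ray]
  · simp [qy, ray, coeff_X, ha]

/-- Coefficients of a product with left factor supported on the ray through `(1, n)`. -/
theorem ray_qmul (γ : ℕ) (β : ℤ) (n : ℕ) (f : K⟦X⟧) (G : QP) (a b : ℕ) :
    qmul γ (ray γ β n f) G (a, b) = ∑ i ∈ Finset.range (a + 1), if n * i ≤ b then
      v ^ (2 * γ * (n * i) * (a - i)) * (coeff i f * v ^ (β * i + (γ * n * i ^ 2 : ℕ)))
        * G (a - i, b - n * i) else 0 := by
  refine Finset.sum_congr rfl fun i _ => ?_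
  simp only [ray, mul_ite, ite_mul, mul_zero, zero_mul]
  rw [Finset.sum_ite_eq' (Finset.range (b + 1)) (n * i)]
  simp only [Finset.mem_range, Nat.lt_succ_iff]

theorem ray_qmul_ray (γ : ℕ) (β : ℤ) (n : ℕ) (f g : K⟦X⟧) :
    qmul γ (ray γ β n f) (ray γ β n g) = ray γ β n (f * g) := by
  funext ⟨a, b⟩
  rw [ray_qmul]
  simp only [ray]
  split_ifs with hb
  · subst hb
    rw [coeff_mul, Finset.Nat.sum_antidiagonal_eq_sum_range_succ_mk, Finset.sum_mul]
    refine Finset.sum_congr rfl fun i hi => ?_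
    obtain ⟨j, rfl⟩ : ∃ j, a = i + j :=
      Nat.exists_eq_add_of_le (by have := Finset.mem_range.1 hi; omega)
    rw [if_pos (by gcongr; omega), Nat.add_sub_cancel_left, if_pos (by rw [mul_add]; omega)]
    have hv : v ^ (β * ((i + j : ℕ) : ℤ) + (γ * n * (i + j) ^ 2 : ℕ))
        = v ^ (2 * γ * (n * i) * j) * v ^ (β * (i : ℤ) + (γ * n * i ^ 2 : ℕ))
          * v ^ (β * (j : ℤ) + (γ * n * j ^ 2 : ℕ)) := by
      rw [← zpow_natCast v (2 * γ * (n * i) * j), ← zpow_add₀ v_ne_zero, ← zpow_add₀ v_ne_zero]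
      congr 1
      push_cast
      ring
    rw [hv]
    ring
  · refine Finset.sum_eq_zero fun i hi => ?_
    split_ifs with h1 h2
    · refine absurd ?_ hb
      obtain ⟨j, rfl⟩ : ∃ j, a = i + j :=
        Nat.exists_eq_add_of_le (by have := Finset.mem_range.1 hi; omega)
      rw [Nat.add_sub_cancel_left] at h2
      rw [mul_add]
      omega
    · exact mul_zero _
    · rfl

theorem qpow_ray (γ : ℕ) (β : ℤ) (n : ℕ) (f : K⟦X⟧) (k : ℕ) :
    qpow γ (ray γ β n f) k = ray γ β n (f ^ k) := by
  induction k with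
  | zero => rw [qpow, pow_zero, ← qone_eq_ray]
  | succ k ih => rw [qpow, ih, ray_qmul_ray, pow_succ']

theorem qarg_ray (γ : ℕ) (w : K) (β : ℤ) (n : ℕ) :
    qarg γ w (qy γ β 1 n) = ray γ β n (dilogExponent w) := by
  funext ⟨a, b⟩
  rw [qarg, qy_eq_ray]
  simp only [qpow_ray, ray, coeff_X_pow]
  split_ifs with hb
  · simp only [ite_mul, one_mul, zero_mul, mul_ite, mul_zero]
    rw [Finset.sum_ite_eq, dilogExponent, coeff_mk]
    split_ifs with ha
    · rfl
    · obtain rfl : a = 0 := by rw [Finset.mem_Icc] at ha; omega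
      simp
  · simp

theorem qPsi_ray (γ : ℕ) (w : K) (β : ℤ) (n : ℕ) :
    qPsi γ w (qy γ β 1 n) = ray γ β n (dilog w) := by
  funext ⟨a, b⟩
  rw [qPsi, qarg_ray]
  simp only [qpow_ray, ray]
  split_ifs with hb
  · rw [dilog, coeff_expComp (coeff_zero_dilogExponent w) (show a < a + b + 1 by omega),
      Finset.sum_mul]
    exact Finset.sum_congr rfl fun k _ => (mul_assoc _ _ _).symm
  · simp

theorem ray_rescale (γ : ℕ) (β d : ℤ) (n : ℕ) (f : K⟦X⟧) :
    ray γ β n (rescale (v ^ d) f) = ray γ (β + d) n f := by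
  funext ⟨a, b⟩
  simp only [ray, coeff_rescale]
  congr 1
  rw [mul_right_comm, mul_comm _ (coeff a f), ← zpow_natCast (v ^ d), ← zpow_mul, mul_assoc,
    ← zpow_add₀ v_ne_zero]
  congr 2
  ring

theorem transpose_transpose (F : QP) : transpose (transpose F) = F := rfl

theorem transpose_qone : transpose qone = qone := by
  funext ⟨a, b⟩
  simp [transpose, qone, and_comm]

theorem transpose_qmul (γ : ℕ) (F G : QP) :
    transpose (qmul γ F G) = qmul γ (transpose G) (transpose F) := by
  funext ⟨m, n⟩
  simp only [transpose, qmul, Prod.swap_prod_mk]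
  rw [Finset.sum_comm, ← Finset.sum_range_reflect]
  refine Finset.sum_congr rfl fun a ha => ?_
  rw [← Finset.sum_range_reflect]
  refine Finset.sum_congr rfl fun b hb => ?_
  have ha := Finset.mem_range.1 ha
  have hb := Finset.mem_range.1 hb
  rw [show m + 1 - 1 - a = m - a by omega, show n + 1 - 1 - b = n - b by omega,
    show m - (m - a) = a by omega, show n - (n - b) = b by omega]
  ring

theorem qone_qmul (γ : ℕ) (F : QP) : qmul γ qone F = F := by
  funext ⟨a, b⟩
  rw [qone_eq_ray γ 0 0, ray_qmul, Finset.sum_eq_single 0]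
  · simp
  · intro i _ hi
    simp [coeff_one, hi]
  · simp

theorem qmul_qone (γ : ℕ) (F : QP) : qmul γ F qone = F := by
  rw [← transpose_transpose (qmul γ F qone), transpose_qmul, transpose_qone, qone_qmul,
    transpose_transpose]

theorem qpow_succ' (γ : ℕ) (Z : QP) (k : ℕ) : qpow γ Z (k + 1) = qmul γ (qpow γ Z k) Z := by
  induction k with
  | zero => exact (qmul_qone γ Z).trans (qone_qmul γ Z).symm
  | succ k ih => rw [qpow, ih, ← qmul_assoc, ← ih, qpow]

theorem transpose_qpow (γ : ℕ) (Z : QP) (k : ℕ) :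
    transpose (qpow γ Z k) = qpow γ (transpose Z) k := by
  induction k with
  | zero => exact transpose_qone
  | succ k ih => rw [qpow, transpose_qmul, ih, qpow_succ']

theorem transpose_qarg (γ : ℕ) (w : K) (Z : QP) :
    transpose (qarg γ w Z) = qarg γ w (transpose Z) := by
  funext ⟨a, b⟩
  simp only [qarg, ← transpose_qpow]
  simp only [transpose, Prod.swap_prod_mk, qarg, add_comm b a]

theorem transpose_qPsi (γ : ℕ) (w : K) (Z : QP) :
    transpose (qPsi γ w Z) = qPsi γ w (transpose Z) := by
  funext ⟨a, b⟩
  simp only [qPsi, ← transpose_qpow, ← transpose_qarg]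
  simp only [transpose, Prod.swap_prod_mk, qPsi, add_comm b a]

theorem transpose_qy (γ : ℕ) (β : ℤ) (m n : ℕ) : transpose (qy γ β m n) = qy γ β n m := by
  funext ⟨a, b⟩
  simp only [transpose, qy, Prod.swap_prod_mk, Prod.mk.injEq, and_comm]
  rw [mul_right_comm]

/-- The quantum dilogarithm `Ψ_w(v^β y^{(m,n)})`. -/
def qdilog (γ : ℕ) (w : K) (β : ℤ) (m n : ℕ) : QP := qPsi γ w (qy γ β m n)

theorem transpose_qdilog (γ : ℕ) (w : K) (β : ℤ) (m n : ℕ) :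
    transpose (qdilog γ w β m n) = qdilog γ w β n m := by
  rw [qdilog, transpose_qPsi, transpose_qy, qdilog]

theorem qdilog_one_left (γ : ℕ) (w : K) (β : ℤ) (n : ℕ) :
    qdilog γ w β 1 n = ray γ β n (dilog w) :=
  qPsi_ray γ w β n

theorem qdilog_zero_one (γ : ℕ) (w : K) (β : ℤ) :
    qdilog γ w β 0 1 = transpose (ray γ β 0 (dilog w)) := by
  rw [← transpose_qdilog, qdilog_one_left]

/-- `Ψ_w(v^β Y₂)·G` coefficientwise. -/
theorem qdilog_zero_one_qmul (γ : ℕ) (w : K) (β : ℤ) (G : QP) (a b : ℕ) :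
    qmul γ (qdilog γ w β 0 1) G (a, b) = ∑ j ∈ Finset.range (b + 1),
      v ^ (2 * γ * j * a) * (coeff j (dilog w) * v ^ (β * j)) * G (a, b - j) := by
  rw [qdilog_zero_one, qmul, Finset.sum_eq_single 0]
  · simp [transpose, ray]
  · intro i _ hi
    simp [transpose, ray, hi]
  · simp

theorem ray_qmul_qdilog_zero_one (γ : ℕ) (w : K) (β β' : ℤ) (n : ℕ) (f : K⟦X⟧) (a b : ℕ) :
    qmul γ (ray γ β n f) (qdilog γ w β' 0 1) (a, b) = if n * a ≤ b then
      coeff a f * v ^ (β * a + (γ * n * a ^ 2 : ℕ))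
        * (coeff (b - n * a) (dilog w) * v ^ (β' * (b - n * a : ℕ))) else 0 := by
  rw [ray_qmul, qdilog_zero_one, Finset.sum_range_succ, Finset.sum_eq_zero]
  · simp [transpose, ray]
  · intro i hi
    have : a - i ≠ 0 := by have := Finset.mem_range.1 hi; omega
    simp [transpose, ray, this]

theorem sum_dilog_coeff {w : K} (hw0 : w ≠ 0) (hw : ∀ k : ℕ, w ^ (k + 1) ≠ 1) (a M : ℕ) :
    ∑ k ∈ Finset.range (a + 1), (if k ≤ M then coeff (a - k) (dilog w) * coeff k (dilog w)
        * coeff (M - k) (dilog w) * w ^ (k ^ 2) else 0)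
      = coeff a (dilog w) * coeff M (dilog w) * w ^ (2 * a * M) := by
  have h := congrArg (coeff M) (dilog_mul_dilogFactor hw0 hw a)
  rw [coeff_mul, Finset.Nat.sum_antidiagonal_eq_sum_range_succ_mk, coeff_C_mul, coeff_rescale,
    ← pow_mul] at h
  rw [mul_assoc, mul_comm (coeff M _), ← h, ← Finset.sum_filter]
  simp only [dilogFactor, coeff_mk, ite_mul, zero_mul]
  rw [← Finset.sum_filter]
  refine Finset.sum_congr ?_ fun k _ => by ring
  ext k
  simp only [Finset.mem_filter, Finset.mem_range]
  omega

/-- The pentagon identity for the quantum dilogarithm. -/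
theorem qdilog_pentagon {γ : ℕ} (hγ : γ ≠ 0) (β β' : ℤ) (n : ℕ) :
    qmul γ (qdilog γ (v ^ γ) β' 0 1) (qdilog γ (v ^ γ) β 1 n)
      = qmul γ (qdilog γ (v ^ γ) β 1 n)
          (qmul γ (qdilog γ (v ^ γ) (β + β') 1 (n + 1)) (qdilog γ (v ^ γ) β' 0 1)) := by
  have hw0 : v ^ γ ≠ 0 := pow_ne_zero γ v_ne_zero
  have hw : ∀ k : ℕ, (v ^ γ) ^ (k + 1) ≠ 1 := fun k => by
    rw [← pow_mul]
    exact v_pow_ne_one (mul_ne_zero hγ k.succ_ne_zero)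
  funext ⟨a, b⟩
  rw [qdilog_zero_one_qmul, qdilog_one_left, qdilog_one_left, ray_qmul]
  simp only [ray_qmul_qdilog_zero_one]
  rcases le_or_gt (n * a) b with hb | hb
  · obtain ⟨M, rfl⟩ := Nat.exists_eq_add_of_le hb
    rw [Finset.sum_eq_single M]
    · rw [ray, if_pos (by simp)]
      have h := congrArg (· * v ^ (β * a + β' * M + (γ * n * a ^ 2 : ℕ)))
        (sum_dilog_coeff hw0 hw a M)
      simp only [Finset.sum_mul, ite_mul, zero_mul] at h
      rw [← Finset.sum_range_reflect]
      trans coeff a (dilog (v ^ γ)) * coeff M (dilog (v ^ γ)) * (v ^ γ) ^ (2 * a * M)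
        * v ^ (β * a + β' * M + (γ * n * a ^ 2 : ℕ))
      · rw [zpow_add₀ v_ne_zero, zpow_add₀ v_ne_zero, zpow_add₀ v_ne_zero, ← pow_mul]
        ring
      rw [← h]
      refine Finset.sum_congr rfl fun k hk => ?_
      obtain ⟨d, rfl⟩ : ∃ d, a = k + d :=
        Nat.exists_eq_add_of_le (by have := Finset.mem_range.1 hk; omega)
      rw [show k + d + 1 - 1 - k = d by omega, show k + d - d = k by omega,
        show k + d - k = d by omega, if_pos (show n * d ≤ n * (k + d) + M by rw [mul_add]; omega),
        show n * (k + d) + M - n * d = n * k + M by rw [mul_add]; omega]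
      have hkM : (n + 1) * k ≤ n * k + M ↔ k ≤ M := by rw [add_mul]; omega
      simp only [hkM]
      split_ifs with h1
      · obtain ⟨j, rfl⟩ := Nat.exists_eq_add_of_le h1
        rw [show n * k + (k + j) - (n + 1) * k = j by rw [add_mul]; omega,
          show k + j - k = j by omega]
        have hv : (v ^ γ) ^ (k ^ 2) * v ^ (β * (k + d : ℕ) + β' * (k + j : ℕ)
              + (γ * n * (k + d) ^ 2 : ℕ))
            = v ^ (2 * γ * (n * d) * k) * v ^ (β * (d : ℤ) + (γ * n * d ^ 2 : ℕ))
              * v ^ ((β + β') * (k : ℤ) + (γ * (n + 1) * k ^ 2 : ℕ)) * v ^ (β' * (j : ℤ)) := by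
          rw [← pow_mul]
          simp only [← zpow_natCast v, ← zpow_add₀ v_ne_zero]
          congr 1
          push_cast
          ring
        linear_combination coeff d (dilog (v ^ γ)) * coeff k (dilog (v ^ γ))
          * coeff j (dilog (v ^ γ)) * hv
      · rw [mul_zero]
    · intro j hj hjM
      rw [ray, if_neg (by have := Finset.mem_range.1 hj; simp only; omega), mul_zero]
    · intro h
      exact absurd (Finset.mem_range.2 (by omega)) h
  · rw [Finset.sum_eq_zero, Finset.sum_eq_zero]
    · intro i hi
      obtain ⟨d, rfl⟩ : ∃ d, a = i + d :=
        Nat.exists_eq_add_of_le (by have := Finset.mem_range.1 hi; omega)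
      rw [mul_add] at hb
      split_ifs with h1 h2
      · rw [Nat.add_sub_cancel_left, add_mul] at h2
        omega
      · exact mul_zero _
      · rfl
    · intro j hj
      rw [ray, if_neg (by simp only; omega), mul_zero]

theorem qdilog_merge_one_left (γ : ℕ) {e : ℕ} (he : e ≠ 0) {ε : ℤ} (hε : ε = 1 ∨ ε = -1) (β : ℤ)
    (n : ℕ) : qmul γ (qdilog γ (v ^ (2 * e)) (β + ε * e) 1 n)
      (qdilog γ (v ^ (2 * e)) (β - ε * e) 1 n) = qdilog γ (v ^ e) β 1 n := by
  have h := dilog_eq_rescale_mul_rescale (pow_ne_zero e v_ne_zero) (fun k => by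
    rw [← pow_mul]
    exact v_pow_ne_one (mul_ne_zero he k.succ_ne_zero))
  rw [← pow_mul, mul_comm e 2, ← zpow_natCast v e, ← zpow_neg] at h
  simp only [qdilog_one_left, sub_eq_add_neg]
  rw [← ray_rescale, ← ray_rescale, ray_qmul_ray, ← zpow_natCast v e, h]
  rcases hε with rfl | rfl
  · simp
  · simp [mul_comm]

theorem qdilog_merge_zero_one (γ : ℕ) {e : ℕ} (he : e ≠ 0) (β : ℤ) :
    qmul γ (qdilog γ (v ^ (2 * e)) (β + e) 0 1) (qdilog γ (v ^ (2 * e)) (β - e) 0 1)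
      = qdilog γ (v ^ e) β 0 1 := by
  have h := qdilog_merge_one_left γ he (Or.inr rfl) β 0
  rw [← transpose_qdilog γ _ β, ← h, transpose_qmul, transpose_qdilog, transpose_qdilog]
  simp [sub_eq_add_neg]

/-- The completed quantum plane as a monoid under the twisted product. -/
def QPlane (_γ : ℕ) : Type := QP

instance (γ : ℕ) : Monoid (QPlane γ) where
  mul := qmul γ
  one := qone
  mul_assoc := qmul_assoc γ
  one_mul := qone_qmul γ
  mul_one := qmul_qone γ

/-- The exchange of `Y₁` and `Y₂` as a monoid homomorphism to the opposite monoid. -/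
def transposeHom (γ : ℕ) : QPlane γ →* (QPlane γ)ᵐᵒᵖ where
  toFun F := MulOpposite.op (transpose F)
  map_one' := congrArg MulOpposite.op transpose_qone
  map_mul' F G := congrArg MulOpposite.op (transpose_qmul γ F G)

/-- `Ψ_w(v^β y^{(m,n)})` as an element of the monoid `QPlane γ`. -/
def Psi (γ : ℕ) (w : K) (β : ℤ) (m n : ℕ) : QPlane γ := qdilog γ w β m n

/-- The pentagon identity of type `B₂`. -/
theorem Psi_pentagon_B {e : ℕ} (he : e ≠ 0) (β β' : ℤ) (n : ℕ) :
    Psi (2 * e) (v ^ e) β' 0 1 * Psi (2 * e) (v ^ (2 * e)) β 1 n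
      = Psi (2 * e) (v ^ (2 * e)) β 1 n * Psi (2 * e) (v ^ e) (β + β') 1 (n + 1)
        * Psi (2 * e) (v ^ (2 * e)) (β + 2 * β') 1 (n + 2) * Psi (2 * e) (v ^ e) β' 0 1 := by
  have pent : ∀ (β β' : ℤ) (n : ℕ), Psi (2 * e) (v ^ (2 * e)) β' 0 1
      * Psi (2 * e) (v ^ (2 * e)) β 1 n = Psi (2 * e) (v ^ (2 * e)) β 1 n
        * (Psi (2 * e) (v ^ (2 * e)) (β + β') 1 (n + 1) * Psi (2 * e) (v ^ (2 * e)) β' 0 1) :=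
    qdilog_pentagon (mul_ne_zero two_ne_zero he)
  have hU : Psi (2 * e) (v ^ (2 * e)) (β' + e) 0 1 * Psi (2 * e) (v ^ (2 * e)) (β' - e) 0 1
      = Psi (2 * e) (v ^ e) β' 0 1 := qdilog_merge_zero_one _ he β'
  have hS : Psi (2 * e) (v ^ (2 * e)) (β + β' + e) 1 (n + 1)
      * Psi (2 * e) (v ^ (2 * e)) (β + β' - e) 1 (n + 1)
        = Psi (2 * e) (v ^ e) (β + β') 1 (n + 1) := by
    have := qdilog_merge_one_left (2 * e) he (Or.inl rfl) (β + β') (n + 1)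
    rwa [one_mul] at this
  have h1 := pent β (β' - e) n
  have h2 := pent β (β' + e) n
  have h3 := pent (β + (β' - e)) (β' + e) (n + 1)
  rw [← add_assoc] at h2
  rw [show β + (β' - e) + (β' + e) = β + 2 * β' by ring,
    show β + (β' - e) = β + β' - e by ring] at h3
  rw [show β + (β' - e) = β + β' - e by ring] at h1
  rw [← hU, mul_assoc, h1, ← mul_assoc, h2, ← hS]
  simp only [mul_assoc]
  rw [← mul_assoc (Psi (2 * e) (v ^ (2 * e)) (β' + e) 0 1) (Psi _ _ (β + β' - e) _ _), h3]
  simp only [mul_assoc]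

theorem mul_list_prod_of_pentagon {M : Type*} [Monoid M] {U : M} {P S E : ℕ → M}
    (hP : ∀ p, U * P p = P p * S (2 * p + 1) * E p * U)
    (hE : ∀ p, E p * P (p + 1) = S (2 * p + 2)) (ℓ : ℕ) :
    U * ((List.range' 0 (ℓ + 1)).map P).prod
      = P 0 * (((List.range' 1 (2 * ℓ + 1)).map S).prod * (E ℓ * U)) := by
  induction ℓ with
  | zero => simp [hP, mul_assoc]
  | succ ℓ ih =>
    rw [List.range'_concat, List.map_append, List.prod_append, ← mul_assoc, ih,
      show 2 * (ℓ + 1) + 1 = 2 * ℓ + 1 + 1 + 1 by ring, List.range'_concat (n := 2 * ℓ + 1 + 1),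
      List.range'_concat (n := 2 * ℓ + 1)]
    simp only [List.map_append, List.prod_append, List.map_singleton, List.prod_singleton,
      mul_assoc, zero_add, one_mul]
    rw [hP, show 1 + (2 * ℓ + 1) = 2 * ℓ + 2 by ring, ← hE]
    simp only [mul_assoc, show 1 + (2 * ℓ + 1 + 1) = 2 * (ℓ + 1) + 1 by ring]

theorem Psi_mul_list_prod {e : ℕ} (he : e ≠ 0) (β β' : ℤ) {ε : ℤ} (hε : ε = 1 ∨ ε = -1) (ℓ : ℕ) :
    Psi (2 * e) (v ^ e) β' 0 1 * ((List.range' 0 (ℓ + 1)).map fun p : ℕ =>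
        Psi (2 * e) (v ^ (2 * e)) (β + 2 * (p : ℤ) * β' + 2 * (p : ℤ) * ε * (e : ℤ)) 1 (2 * p)).prod
      = Psi (2 * e) (v ^ (2 * e)) β 1 0 * (((List.range' 1 (2 * ℓ + 1)).map fun p : ℕ =>
          Psi (2 * e) (v ^ e) (β + (p : ℤ) * β' + ((p : ℤ) - 1) * ε * (e : ℤ)) 1 p).prod
        * (Psi (2 * e) (v ^ (2 * e)) (β + (2 * (ℓ : ℤ) + 2) * β' + 2 * (ℓ : ℤ) * ε * (e : ℤ)) 1
            (2 * ℓ + 2) * Psi (2 * e) (v ^ e) β' 0 1)) := by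
  have h := mul_list_prod_of_pentagon (U := Psi (2 * e) (v ^ e) β' 0 1)
    (P := fun p => Psi (2 * e) (v ^ (2 * e)) (β + 2 * (p : ℤ) * β' + 2 * (p : ℤ) * ε * (e : ℤ)) 1
      (2 * p))
    (S := fun p => Psi (2 * e) (v ^ e) (β + (p : ℤ) * β' + ((p : ℤ) - 1) * ε * (e : ℤ)) 1 p)
    (E := fun p => Psi (2 * e) (v ^ (2 * e))
      (β + (2 * (p : ℤ) + 2) * β' + 2 * (p : ℤ) * ε * (e : ℤ)) 1 (2 * p + 2)) ?_ ?_ ℓ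
  · simpa using h
  · intro p
    rw [Psi_pentagon_B he]
    have h1 : β + 2 * (p : ℤ) * β' + 2 * (p : ℤ) * ε * e + β'
        = β + ((2 * p + 1 : ℕ) : ℤ) * β' + (((2 * p + 1 : ℕ) : ℤ) - 1) * ε * e := by
      push_cast
      ring
    have h2 : β + 2 * (p : ℤ) * β' + 2 * (p : ℤ) * ε * e + 2 * β'
        = β + (2 * (p : ℤ) + 2) * β' + 2 * (p : ℤ) * ε * e := by ring
    rw [h1, h2]
  · intro p
    have h := qdilog_merge_one_left (2 * e) he (ε := -ε) (by omega)
      (β + ((2 * p + 2 : ℕ) : ℤ) * β' + (((2 * p + 2 : ℕ) : ℤ) - 1) * ε * (e : ℤ)) (2 * p + 2)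
    refine Eq.trans ?_ h
    change Psi _ _ _ _ _ * Psi _ _ _ _ _ = Psi _ _ _ _ _ * Psi _ _ _ _ _
    congr 2 <;> (push_cast; ring)

theorem unop_transposeHom_Psi (γ : ℕ) (w : K) (β : ℤ) (m n : ℕ) :
    (transposeHom γ (Psi γ w β m n)).unop = Psi γ w β n m :=
  transpose_qdilog γ w β m n

theorem list_prod_mul_Psi {e : ℕ} (he : e ≠ 0) (β β' : ℤ) {ε : ℤ} (hε : ε = 1 ∨ ε = -1) (ℓ : ℕ) :
    ((List.range' 0 (ℓ + 1)).reverse.map fun p : ℕ =>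
        Psi (2 * e) (v ^ (2 * e)) (2 * (p : ℤ) * β + β' + 2 * (p : ℤ) * ε * (e : ℤ)) (2 * p) 1).prod
        * Psi (2 * e) (v ^ e) β 1 0
      = Psi (2 * e) (v ^ e) β 1 0 * (Psi (2 * e) (v ^ (2 * e))
            ((2 * (ℓ : ℤ) + 2) * β + β' + 2 * (ℓ : ℤ) * ε * (e : ℤ)) (2 * ℓ + 2) 1
          * (((List.range' 1 (2 * ℓ + 1)).reverse.map fun p : ℕ =>
              Psi (2 * e) (v ^ e) ((p : ℤ) * β + β' + ((p : ℤ) - 1) * ε * (e : ℤ)) p 1).prod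
            * Psi (2 * e) (v ^ (2 * e)) β' 0 1)) := by
  have h := congrArg (fun F => (transposeHom (2 * e) F).unop) (Psi_mul_list_prod he β' β hε ℓ)
  simp only [map_mul, MulOpposite.unop_mul, unop_map_list_prod, List.map_map,
    Function.comp_def, unop_transposeHom_Psi, add_comm β', mul_assoc] at h
  simpa only [List.map_reverse, mul_assoc] using h

end QuantumPlane

/-- Lemma A.2, quantum-plane form: in `A_{2e}`, for `ε = ±1` and `ℓ ≥ 0`,
(i) `Ψ_{v^e}(v^{β'}Y₂)·→∏_{p=0..ℓ} Ψ_{v^{2e}}(v^{β+2pβ'+2pεe}y^{(1,2p)})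
  = Ψ_{v^{2e}}(v^{β}Y₁)·(→∏_{p=1..2ℓ+1} Ψ_{v^e}(v^{β+pβ'+(p−1)εe}y^{(1,p)}))·
    Ψ_{v^{2e}}(v^{β+(2ℓ+2)β'+2ℓεe}y^{(1,2ℓ+2)})·Ψ_{v^e}(v^{β'}Y₂)`, and
(ii) `(←∏_{p=0..ℓ} Ψ_{v^{2e}}(v^{2pβ+β'+2pεe}y^{(2p,1)}))·Ψ_{v^e}(v^{β}Y₁)
  = Ψ_{v^e}(v^{β}Y₁)·Ψ_{v^{2e}}(v^{(2ℓ+2)β+β'+2ℓεe}y^{(2ℓ+2,1)})·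
    (←∏_{p=1..2ℓ+1} Ψ_{v^e}(v^{pβ+β'+(p−1)εe}y^{(p,1)}))·Ψ_{v^{2e}}(v^{β'}Y₂)`. -/
theorem lemma_A2 (e : ℕ) (he : 0 < e) (β β' ε : ℤ) (hε : ε = 1 ∨ ε = -1) (ℓ : ℕ) :
    (qmul (2 * e) (qPsi (2 * e) (v ^ e) (qy (2 * e) β' 0 1))
        (qprodR (2 * e)
          (fun p => qPsi (2 * e) (v ^ (2 * e))
            (qy (2 * e) (β + 2 * (p : ℤ) * β' + 2 * (p : ℤ) * ε * (e : ℤ)) 1 (2 * p))) 0 ℓ)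
      = qmul (2 * e) (qPsi (2 * e) (v ^ (2 * e)) (qy (2 * e) β 1 0))
          (qmul (2 * e)
            (qprodR (2 * e)
              (fun p => qPsi (2 * e) (v ^ e)
                (qy (2 * e) (β + (p : ℤ) * β' + ((p : ℤ) - 1) * ε * (e : ℤ)) 1 p)) 1 (2 * ℓ + 1))
            (qmul (2 * e)
              (qPsi (2 * e) (v ^ (2 * e))
                (qy (2 * e) (β + (2 * (ℓ : ℤ) + 2) * β' + 2 * (ℓ : ℤ) * ε * (e : ℤ)) 1 (2 * ℓ + 2)))
              (qPsi (2 * e) (v ^ e) (qy (2 * e) β' 0 1)))))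
    ∧
    (qmul (2 * e)
        (qprodL (2 * e)
          (fun p => qPsi (2 * e) (v ^ (2 * e))
            (qy (2 * e) (2 * (p : ℤ) * β + β' + 2 * (p : ℤ) * ε * (e : ℤ)) (2 * p) 1)) 0 ℓ)
        (qPsi (2 * e) (v ^ e) (qy (2 * e) β 1 0))
      = qmul (2 * e) (qPsi (2 * e) (v ^ e) (qy (2 * e) β 1 0))
          (qmul (2 * e)
            (qPsi (2 * e) (v ^ (2 * e))
              (qy (2 * e) ((2 * (ℓ : ℤ) + 2) * β + β' + 2 * (ℓ : ℤ) * ε * (e : ℤ)) (2 * ℓ + 2) 1))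
            (qmul (2 * e)
              (qprodL (2 * e)
                (fun p => qPsi (2 * e) (v ^ e)
                  (qy (2 * e) ((p : ℤ) * β + β' + ((p : ℤ) - 1) * ε * (e : ℤ)) p 1)) 1 (2 * ℓ + 1))
              (qPsi (2 * e) (v ^ (2 * e)) (qy (2 * e) β' 0 1))))) := by
  exact ⟨Psi_mul_list_prod he.ne' β β' hε ℓ, list_prod_mul_Psi he.ne' β β' hε ℓ⟩
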